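/- Let r > 0 be a fixed radius, δ ∈ (0,1), and let n ≥ 2 be even. Then with probability at least 1 − δ over an i.i.d. sample S = ((x₁,y₁),…,(xₙ,yₙ)) ~ Dⁿ, simultaneously for all μ ∈ ℝᵖ with ‖μ‖₂ ≤ r: R̂_S(μ) ≤ R(μ) + 2 r ‖κ‖₂ √(2/n) + (1 + r‖κ‖₂) √(2 log(1/δ)/n). -/

import Mathlib

open MeasureTheory Finset

noncomputable section

/-- The ±1 real value of a Boolean label: `true ↦ 1`, `false ↦ -1`.
We encode the label space {−1, 1} by `Bool`. -/
def sgn (b : Bool) : ℝ := if b then 1 else -1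

/-- The Euclidean (L2) norm on ℝᵖ. -/
def l2norm {p : ℕ} (μ : Fin p → ℝ) : ℝ := Real.sqrt (∑ i, μ i ^ 2)

/-- The L1 norm on ℝᵖ. -/
def l1norm {p : ℕ} (μ : Fin p → ℝ) : ℝ := ∑ i, |μ i|

/-- The L∞ (supremum) norm on ℝᵖ. -/
def linfnorm {p : ℕ} (μ : Fin p → ℝ) : ℝ := ⨆ i, |μ i|

/-- The standard inner product on ℝᵖ. -/
def ip {p : ℕ} (μ v : Fin p → ℝ) : ℝ := ∑ i, μ i * v i

/-- The K-space feature map `z(x,x') = (K₁(x,x'),…,K_p(x,x'))`. -/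
def zmap {X : Type*} {p : ℕ} (K : Fin p → X → X → ℝ) (x x' : X) : Fin p → ℝ :=
  fun i => K i x x'

/-- The pairwise hinge loss `ℓ(μ, (x,y), (x',y')) = max(0, 1 − y y' ⟨μ, z(x,x')⟩)`. -/
def hinge {X : Type*} {p : ℕ} (K : Fin p → X → X → ℝ) (μ : Fin p → ℝ)
    (w w' : X × Bool) : ℝ :=
  max 0 (1 - sgn w.2 * sgn w'.2 * ip μ (zmap K w.1 w'.1))

/-- The empirical risk `R̂_S(μ) = (2/(n(n−1))) Σ_{1≤i<j≤n} ℓ(μ, (xᵢ,yᵢ), (xⱼ,yⱼ))`. -/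
def empRisk {X : Type*} {p n : ℕ} (K : Fin p → X → X → ℝ)
    (S : Fin n → X × Bool) (μ : Fin p → ℝ) : ℝ :=
  (2 / ((n : ℝ) * ((n : ℝ) - 1))) *
    ∑ i : Fin n, ∑ j : Fin n, if i < j then hinge K μ (S i) (S j) else 0

/-- The true risk `R(μ) = E_{((x,y),(x',y')) ~ D×D}[max(0, 1 − y y' ⟨μ, z(x,x')⟩)]`. -/
def trueRisk {X : Type*} [MeasurableSpace X] {p : ℕ} (K : Fin p → X → X → ℝ)
    (D : Measure (X × Bool)) (μ : Fin p → ℝ) : ℝ :=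
  ∫ w, hinge K μ w.1 w.2 ∂(D.prod D)

/-- Expectation over m i.i.d. Rademacher random variables (uniform on {−1,+1}),
encoded by Booleans mapped to ±1 via `sgn`. -/
def radE {m : ℕ} (f : (Fin m → Bool) → ℝ) : ℝ :=
  (∑ ε : Fin m → Bool, f ε) / 2 ^ m

lemma integrable_of_abs_le {Ω : Type*} [MeasurableSpace Ω] {P : Measure Ω} [IsFiniteMeasure P]
    {f : Ω → ℝ} {C : ℝ} (hf : Measurable f) (hC : ∀ w, |f w| ≤ C) : Integrable f P :=
  Integrable.of_bound hf.aestronglyMeasurable C (Filter.Eventually.of_forall hC)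

lemma abs_integral_le_of_abs_le {Ω : Type*} [MeasurableSpace Ω] {P : Measure Ω}
    [IsProbabilityMeasure P] {f : Ω → ℝ} {C : ℝ} (hC : ∀ w, |f w| ≤ C) : |∫ w, f w ∂P| ≤ C := by
  simpa using norm_integral_le_of_norm_le_const (μ := P) (f := f)
    (Filter.Eventually.of_forall hC)

lemma measurable_finCons {Z : Type*} [MeasurableSpace Z] {m : ℕ} :
    Measurable fun q : (Fin m → Z) × Z => (Fin.cons q.2 q.1 : Fin (m + 1) → Z) := by
  refine measurable_pi_lambda _ fun i => ?_
  refine Fin.cases ?_ (fun j => ?_) i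
  · simpa using measurable_snd
  · simp only [Fin.cons_succ]; fun_prop

lemma measurePreserving_finCons {Z : Type*} [MeasurableSpace Z] (P : Measure Z)
    [IsProbabilityMeasure P] (m : ℕ) :
    MeasurePreserving (fun q : (Fin m → Z) × Z => (Fin.cons q.2 q.1 : Fin (m + 1) → Z))
      ((Measure.pi fun _ : Fin m => P).prod P) (Measure.pi fun _ : Fin (m + 1) => P) := by
  have h := ((measurePreserving_piFinSuccAbove (fun _ : Fin (m + 1) => P) 0).symm).comp
    (Measure.measurePreserving_swap (μ := Measure.pi fun _ : Fin m => P) (ν := P))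
  convert h using 1
  ext q i
  refine Fin.cases ?_ (fun j => ?_) i <;>
    simp [MeasurableEquiv.piFinSuccAbove, Fin.insertNthEquiv]

lemma integral_pi_finCons {Z : Type*} [MeasurableSpace Z] (P : Measure Z)
    [IsProbabilityMeasure P] {m : ℕ} {f : (Fin (m + 1) → Z) → ℝ} {C : ℝ} (hf : Measurable f)
    (hC : ∀ w, |f w| ≤ C) :
    ∫ w, f w ∂(Measure.pi fun _ => P) =
      ∫ s, ∫ z, f (Fin.cons z s) ∂P ∂(Measure.pi fun _ : Fin m => P) := by
  have h := measurePreserving_finCons P m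
  rw [← h.map_eq, integral_map h.measurable.aemeasurable hf.aestronglyMeasurable,
    integral_prod]
  exact integrable_of_abs_le (hf.comp h.measurable) fun q => hC _

/-- Hoeffding's lemma for a function oscillating by at most `c`. -/
lemma integral_exp_le_of_oscillation_le {Z : Type*} [MeasurableSpace Z] (P : Measure Z)
    [IsProbabilityMeasure P] {f : Z → ℝ} {c : ℝ} (hf : Measurable f)
    (hc : ∀ z z', f z ≤ f z' + c) (l : ℝ) :
    ∫ z, Real.exp (l * f z) ∂P ≤ Real.exp (l * ∫ z, f z ∂P + l ^ 2 * c ^ 2 / 8) := by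
  have : Nonempty Z := nonempty_of_isProbabilityMeasure P
  let z₀ := Classical.arbitrary Z
  have hbdd : BddBelow (Set.range f) := ⟨f z₀ - c, by
    rintro _ ⟨z, rfl⟩; linarith [hc z₀ z]⟩
  have hmem : ∀ z, f z ∈ Set.Icc (⨅ z, f z) ((⨅ z, f z) + c) := fun z =>
    ⟨ciInf_le hbdd z, by
      have : f z - c ≤ ⨅ z, f z := le_ciInf fun z' => by linarith [hc z z']
      linarith⟩
  have h := (ProbabilityTheory.hasSubgaussianMGF_of_mem_Icc (μ := P) hf.aemeasurable
    (Filter.Eventually.of_forall hmem)).mgf_le l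
  simp only [ProbabilityTheory.mgf, add_sub_cancel_left] at h
  have hcoe : (((‖c‖₊ / 2) ^ 2 : NNReal) : ℝ) = c ^ 2 / 4 := by
    push_cast; rw [Real.norm_eq_abs, div_pow, sq_abs]; norm_num
  rw [hcoe] at h
  have hsplit : ∀ z, Real.exp (l * f z) =
      Real.exp (l * ∫ z, f z ∂P) * Real.exp (l * (f z - ∫ z, f z ∂P)) := fun z => by
    rw [← Real.exp_add]; congr 1; ring
  simp_rw [hsplit, integral_const_mul, Real.exp_add]
  gcongr
  refine h.trans_eq ?_
  congr 1; ring

/-- The exponential-moment form of McDiarmid's inequality. -/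
lemma integral_exp_le_of_bounded_differences {Z : Type*} [MeasurableSpace Z] (P : Measure Z)
    [IsProbabilityMeasure P] {c C l : ℝ} : ∀ {m : ℕ} {f : (Fin m → Z) → ℝ}, Measurable f →
    (∀ w, |f w| ≤ C) → (∀ w i z, f (Function.update w i z) ≤ f w + c) →
    ∫ w, Real.exp (l * f w) ∂(Measure.pi fun _ => P) ≤
      Real.exp (l * ∫ w, f w ∂(Measure.pi fun _ => P) + m * (l ^ 2 * c ^ 2 / 8)) := by
  intro m
  induction m with
  | zero =>
    intro f _ _ _
    obtain ⟨a, rfl⟩ : ∃ a, f = fun _ => a :=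
      ⟨f Fin.elim0, funext fun w => congrArg f (Subsingleton.elim _ _)⟩
    simp
  | succ m ih =>
    intro f hf hC hc
    have hcons : Measurable fun q : (Fin m → Z) × Z => f (Fin.cons q.2 q.1) :=
      hf.comp measurable_finCons
    have hsec : ∀ s, Measurable fun z => f (Fin.cons z s) := fun s =>
      hcons.comp measurable_prodMk_left
    have hg : Measurable fun s : Fin m → Z => ∫ z, f (Fin.cons z s) ∂P :=
      hcons.stronglyMeasurable.integral_prod_right.measurable
    have hgC : ∀ s : Fin m → Z, |∫ z, f (Fin.cons z s) ∂P| ≤ C := fun s =>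
      abs_integral_le_of_abs_le fun z => hC _
    have hexp : ∀ x : ℝ, |x| ≤ C → |Real.exp (l * x)| ≤ Real.exp (|l| * C) := fun x hx => by
      rw [Real.abs_exp, Real.exp_le_exp]
      exact (le_abs_self _).trans (by rw [abs_mul]; gcongr)
    have hgc : ∀ (s : Fin m → Z) i z', ∫ z, f (Fin.cons z (Function.update s i z')) ∂P ≤
        ∫ z, f (Fin.cons z s) ∂P + c := fun s i z' => by
      have hint : ∀ s : Fin m → Z, Integrable (fun z => f (Fin.cons z s)) P := fun s =>
        integrable_of_abs_le (hsec s) fun z => hC _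
      calc _ ≤ ∫ z, (f (Fin.cons z s) + c) ∂P :=
            integral_mono (hint _) ((hint s).add (integrable_const c)) fun z => by
              simp only [Fin.cons_update]; exact hc _ _ _
        _ = _ := by rw [integral_add (hint s) (integrable_const c)]; simp
    have hinner : ∀ s : Fin m → Z, ∫ z, Real.exp (l * f (Fin.cons z s)) ∂P ≤
        Real.exp (l * ∫ z, f (Fin.cons z s) ∂P) * Real.exp (l ^ 2 * c ^ 2 / 8) := fun s => by
      rw [← Real.exp_add]
      refine integral_exp_le_of_oscillation_le P (hsec s) (fun z z' => ?_) l
      have := hc (Fin.cons z' s) 0 z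
      rwa [Fin.update_cons_zero] at this
    rw [integral_pi_finCons P (f := fun w => Real.exp (l * f w)) (by fun_prop)
      (fun w => hexp _ (hC w)), integral_pi_finCons P hf hC]
    calc _ ≤ ∫ s, Real.exp (l * ∫ z, f (Fin.cons z s) ∂P) * Real.exp (l ^ 2 * c ^ 2 / 8)
          ∂(Measure.pi fun _ : Fin m => P) := by
          refine integral_mono (integrable_of_abs_le (C := Real.exp (|l| * C)) ?_ fun s => ?_)
            ((integrable_of_abs_le (C := Real.exp (|l| * C)) ?_ fun s =>
              hexp _ (hgC s)).mul_const _) hinner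
          · exact (hcons.const_mul l).exp.stronglyMeasurable.integral_prod_right.measurable
          · exact abs_integral_le_of_abs_le fun z => hexp _ (hC _)
          · exact (hg.const_mul l).exp
      _ ≤ Real.exp (l * ∫ s, ∫ z, f (Fin.cons z s) ∂P ∂(Measure.pi fun _ : Fin m => P) +
            m * (l ^ 2 * c ^ 2 / 8)) * Real.exp (l ^ 2 * c ^ 2 / 8) := by
          rw [integral_mul_const]
          gcongr
          exact ih hg hgC hgc
      _ = _ := by
          rw [← Real.exp_add]; congr 1; push_cast; ring

section Supremum

variable {ι : Type*}

lemma bddAbove_range_of_abs_le {f : ι → ℝ} {C : ℝ} (hC : ∀ k, |f k| ≤ C) :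
    BddAbove (Set.range f) :=
  ⟨C, by rintro _ ⟨k, rfl⟩; exact (le_abs_self _).trans (hC k)⟩

lemma abs_ciSup_le_of_abs_le [Nonempty ι] {f : ι → ℝ} {C : ℝ} (hC : ∀ k, |f k| ≤ C) :
    |⨆ k, f k| ≤ C := by
  refine abs_le.2 ⟨?_, ciSup_le fun k => (abs_le.1 (hC k)).2⟩
  let k := Classical.arbitrary ι
  exact (abs_le.1 (hC k)).1.trans (le_ciSup (bddAbove_range_of_abs_le hC) k)

lemma ciSup_add_ciSup_le_of_forall [Nonempty ι] {f g : ι → ℝ} {x : ℝ}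
    (h : ∀ j k, f j + g k ≤ x) : (⨆ k, f k) + ⨆ k, g k ≤ x := by
  have h1 : ∀ j, ⨆ k, g k ≤ x - f j := fun j => ciSup_le fun k => by linarith [h j k]
  have h2 : ⨆ k, f k ≤ x - ⨆ k, g k := ciSup_le fun k => by linarith [h1 k]
  linarith

lemma two_mul_abs_sub_le_ciSup_add_ciSup {a q : ι → ℝ}
    (hp : BddAbove (Set.range fun k => a k + 2 * q k))
    (hm : BddAbove (Set.range fun k => a k - 2 * q k)) (j k : ι) :
    a j + a k + 2 * |q j - q k| ≤ (⨆ k, (a k + 2 * q k)) + ⨆ k, (a k - 2 * q k) := by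
  have hj := le_ciSup hp j
  have hk := le_ciSup hp k
  have hj' := le_ciSup hm j
  have hk' := le_ciSup hm k
  rcases abs_cases (q j - q k) with ⟨h, _⟩ | ⟨h, _⟩ <;> rw [h] <;> linarith

/-- Symmetrization and contraction in a single observation. -/
lemma integral_ciSup_le_of_lipschitz [Countable ι] [Nonempty ι] {Z : Type*} [MeasurableSpace Z]
    (P : Measure Z) [IsProbabilityMeasure P] {a : ι → ℝ} {L q : ι → Z → ℝ} {A B Q : ℝ}
    (ha : ∀ k, |a k| ≤ A) (hLm : ∀ k, Measurable (L k)) (hL : ∀ k z, |L k z| ≤ B)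
    (hqm : ∀ k, Measurable (q k)) (hq : ∀ k z, |q k z| ≤ Q)
    (hLq : ∀ j k z, |L j z - L k z| ≤ |q j z - q k z|) :
    ∫ z, ⨆ k, (a k + (L k z - ∫ z', L k z' ∂P)) ∂P ≤
      ∫ z, ((⨆ k, (a k + 2 * q k z)) + ⨆ k, (a k - 2 * q k z)) / 2 ∂P := by
  set S : Z × Z → ℝ := fun w => ⨆ k, (a k + (L k w.1 - L k w.2)) with hS
  set F : Z → ℝ := fun z => ((⨆ k, (a k + 2 * q k z)) + ⨆ k, (a k - 2 * q k z)) / 2 with hF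
  have hpos : ∀ k z, |a k + 2 * q k z| ≤ A + 2 * Q := fun k z =>
    (abs_add_le _ _).trans (by
      rw [abs_mul, abs_two]; linarith [ha k, hq k z])
  have hneg : ∀ k z, |a k - 2 * q k z| ≤ A + 2 * Q := fun k z =>
    (abs_sub _ _).trans (by
      rw [abs_mul, abs_two]; linarith [ha k, hq k z])
  have hdiff : ∀ k z z', |a k + (L k z - L k z')| ≤ A + 2 * B := fun k z z' =>
    (abs_add_le _ _).trans (by linarith [ha k, hL k z, hL k z', abs_sub (L k z) (L k z')])
  have hSm : Measurable S := Measurable.iSup fun k => by fun_prop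
  have hSC : ∀ w, |S w| ≤ A + 2 * B := fun w => abs_ciSup_le_of_abs_le fun k => hdiff k _ _
  have hSint : Integrable S (P.prod P) := integrable_of_abs_le hSm hSC
  have hFm : Measurable F :=
    ((Measurable.iSup fun k => by fun_prop).add (Measurable.iSup fun k => by fun_prop)).div_const 2
  have hFint : Integrable F P := integrable_of_abs_le (C := A + 2 * Q) hFm fun z => by
    have h1 := abs_ciSup_le_of_abs_le fun k => hpos k z
    have h2 := abs_ciSup_le_of_abs_le fun k => hneg k z
    rw [hF, abs_div, abs_two]
    linarith [abs_add_le (⨆ k, (a k + 2 * q k z)) (⨆ k, (a k - 2 * q k z))]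
  have hpt : ∀ z z', S (z, z') + S (z', z) ≤ F z + F z' := fun z z' => by
    refine ciSup_add_ciSup_le_of_forall fun j k => ?_
    have h1 := two_mul_abs_sub_le_ciSup_add_ciSup (a := a) (q := fun k => q k z)
      (bddAbove_range_of_abs_le fun k => hpos k z)
      (bddAbove_range_of_abs_le fun k => hneg k z) j k
    have h2 := two_mul_abs_sub_le_ciSup_add_ciSup (a := a) (q := fun k => q k z')
      (bddAbove_range_of_abs_le fun k => hpos k z')
      (bddAbove_range_of_abs_le fun k => hneg k z') j k
    have h3 := (le_abs_self _).trans (hLq j k z)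
    have h4 := (neg_le_abs _).trans (hLq j k z')
    simp only [hF]
    linarith
  have hstep : ∫ z, ⨆ k, (a k + (L k z - ∫ z', L k z' ∂P)) ∂P ≤ ∫ w, S w ∂(P.prod P) := by
    rw [integral_prod _ hSint]
    have hR : ∀ k, |∫ z, L k z ∂P| ≤ B := fun k => abs_integral_le_of_abs_le (hL k)
    refine integral_mono (integrable_of_abs_le (C := A + 2 * B)
      (Measurable.iSup fun k => by fun_prop) fun z => abs_ciSup_le_of_abs_le fun k => ?_)
      hSint.integral_prod_left fun z => ciSup_le fun k => ?_
    · refine (abs_add_le _ _).trans ?_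
      linarith [ha k, hL k z, hR k, abs_sub (L k z) (∫ z, L k z ∂P)]
    · have hLint : Integrable (L k) P := integrable_of_abs_le (hLm k) (hL k)
      calc a k + (L k z - ∫ z', L k z' ∂P) = ∫ z', (a k + (L k z - L k z')) ∂P := by
            have h1 := integral_add (integrable_const (a k)) ((integrable_const (L k z)).sub hLint)
            have h2 := integral_sub (integrable_const (L k z)) hLint
            simp only [Pi.sub_apply, integral_const, probReal_univ, one_smul] at h1 h2
            rw [h1, h2]
        _ ≤ ∫ z', S (z, z') ∂P := by
            refine integral_mono ((integrable_const _).add ((integrable_const _).sub hLint))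
              (integrable_of_abs_le (hSm.comp measurable_prodMk_left) fun z' => hSC _) fun z' => ?_
            exact le_ciSup (f := fun k => a k + (L k z - L k z'))
              (bddAbove_range_of_abs_le fun k => hdiff k z z') k
  have hsum : ∫ w, (S w + S w.swap) ∂(P.prod P) ≤ ∫ w, (F w.1 + F w.2) ∂(P.prod P) :=
    integral_mono (hSint.add hSint.swap) ((hFint.comp_fst P).add (hFint.comp_snd P))
      fun w => hpt w.1 w.2
  have hswap := integral_add hSint hSint.swap
  simp only [Function.comp_def] at hswap
  rw [hswap, integral_prod_swap, integral_add (hFint.comp_fst P) (hFint.comp_snd P), integral_fun_fst, integral_fun_snd] at hsum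
  simp only [probReal_univ, one_smul] at hsum
  linarith

end Supremum

section Complexity

variable {ι Z E : Type*} [MeasurableSpace Z] [NormedAddCommGroup E] [InnerProductSpace ℝ E]

lemma sqrt_add_sqrt_div_two_le (u v : E) {c : ℝ} (hc : 0 ≤ c) :
    (√(‖u + v‖ ^ 2 + c) + √(‖u - v‖ ^ 2 + c)) / 2 ≤ √(‖u‖ ^ 2 + ‖v‖ ^ 2 + c) := by
  apply Real.le_sqrt_of_sq_le
  have h := parallelogram_law_with_norm ℝ u v
  have h1 := Real.sq_sqrt (show 0 ≤ ‖u + v‖ ^ 2 + c by positivity)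
  have h2 := Real.sq_sqrt (show 0 ≤ ‖u - v‖ ^ 2 + c by positivity)
  nlinarith [sq_nonneg (√(‖u + v‖ ^ 2 + c) - √(‖u - v‖ ^ 2 + c))]

/-- The expected supremum of an empirical process tilted by a linear functional, for losses that
depend in a Lipschitz way on a linear prediction. -/
lemma integral_ciSup_empirical_le [Countable ι] [Nonempty ι] (P : Measure Z)
    [IsProbabilityMeasure P] {t : ι → E} {L : ι → Z → ℝ} {v : Z → E} {B r κ : ℝ} (hr : 0 ≤ r)
    (ht : ∀ k, ‖t k‖ ≤ r) (hLm : ∀ k, Measurable (L k)) (hL : ∀ k z, |L k z| ≤ B)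
    (hvm : ∀ k, Measurable fun z => inner ℝ (t k) (v z)) (hv : ∀ z, ‖v z‖ ≤ κ)
    (hLv : ∀ j k z, |L j z - L k z| ≤ |inner ℝ (t j) (v z) - inner ℝ (t k) (v z)|) :
    ∀ (m : ℕ) (u : E), ∫ w : Fin m → Z, ⨆ k,
        (inner ℝ (t k) u + ∑ i, (L k (w i) - ∫ z, L k z ∂P)) ∂(Measure.pi fun _ => P) ≤
      r * √(‖u‖ ^ 2 + m * (4 * κ ^ 2)) := by
  have hinner : ∀ k u, |inner ℝ (t k) u| ≤ r * ‖u‖ := fun k u =>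
    (abs_real_inner_le_norm _ _).trans (by gcongr; exact ht k)
  have hR : ∀ k, |∫ z, L k z ∂P| ≤ B := fun k => abs_integral_le_of_abs_le (hL k)
  have hterm : ∀ k z, |L k z - ∫ z, L k z ∂P| ≤ 2 * B := fun k z =>
    (abs_sub _ _).trans (by linarith [hL k z, hR k])
  have hsum : ∀ (m : ℕ) k (w : Fin m → Z) u,
      |inner ℝ (t k) u + ∑ i, (L k (w i) - ∫ z, L k z ∂P)| ≤ r * ‖u‖ + m * (2 * B) :=
    fun m k w u => (abs_add_le _ _).trans (add_le_add (hinner k u)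
      ((abs_sum_le_sum_abs _ _).trans
        ((sum_le_sum fun i _ => hterm k (w i)).trans_eq (by simp))))
  intro m
  induction m with
  | zero =>
    intro u
    simp only [univ_eq_empty, sum_empty, add_zero, Nat.cast_zero, zero_mul, integral_const,
      probReal_univ, one_smul, Real.sqrt_sq (norm_nonneg u)]
    exact ciSup_le fun k => (le_abs_self _).trans (hinner k u)
  | succ m ih =>
    intro u
    set Φ : E → (Fin m → Z) → ℝ := fun u s =>
      ⨆ k, (inner ℝ (t k) u + ∑ i, (L k (s i) - ∫ z, L k z ∂P)) with hΦ
    have hΦC : ∀ (s : Fin m → Z) u, |Φ u s| ≤ r * ‖u‖ + m * (2 * B) := fun s u =>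
      abs_ciSup_le_of_abs_le fun k => hsum m k s u
    have hΦm : ∀ e : ℝ, Measurable fun q : (Fin m → Z) × Z => Φ (u + e • v q.2) q.1 := fun e =>
      Measurable.iSup fun k => by
        simp only [inner_add_right, inner_smul_right]
        have h1 : Measurable fun q : (Fin m → Z) × Z => inner ℝ (t k) (v q.2) :=
          (hvm k).comp measurable_snd
        have h2 : ∀ i, Measurable fun q : (Fin m → Z) × Z => L k (q.1 i) := fun i =>
          (hLm k).comp ((measurable_pi_apply i).comp measurable_fst)
        fun_prop
    have hvC : ∀ (e : ℝ) z, ‖u + e • v z‖ ≤ ‖u‖ + |e| * κ := fun e z =>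
      (norm_add_le _ _).trans (by rw [norm_smul, Real.norm_eq_abs]; gcongr; exact hv z)
    have hΦint : ∀ e : ℝ, Integrable (fun q : (Fin m → Z) × Z => Φ (u + e • v q.2) q.1)
        ((Measure.pi fun _ => P).prod P) := fun e =>
      integrable_of_abs_le (C := r * (‖u‖ + |e| * κ) + m * (2 * B)) (hΦm e) fun q =>
        (hΦC _ _).trans (by gcongr; exact hvC e _)
    set H : (Fin m → Z) × Z → ℝ := fun q =>
      (Φ (u + (2 : ℝ) • v q.2) q.1 + Φ (u + (-2 : ℝ) • v q.2) q.1) / 2 with hH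
    have hHint : Integrable H ((Measure.pi fun _ => P).prod P) :=
      ((hΦint 2).add (hΦint (-2))).div_const 2
    have hmeas : Measurable fun w : Fin (m + 1) → Z =>
        ⨆ k, (inner ℝ (t k) u + ∑ i, (L k (w i) - ∫ z, L k z ∂P)) :=
      Measurable.iSup fun k => by
        have h2 : ∀ i, Measurable fun w : Fin (m + 1) → Z => L k (w i) := fun i =>
          (hLm k).comp (measurable_pi_apply i)
        fun_prop
    have hfst : ∀ s : Fin m → Z, ∫ z, ⨆ k, (inner ℝ (t k) u +
        ∑ i, (L k ((Fin.cons z s : Fin (m + 1) → Z) i) - ∫ z, L k z ∂P)) ∂P ≤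
          ∫ z, H (s, z) ∂P := fun s => by
      have h := integral_ciSup_le_of_lipschitz P (fun k => hsum m k s u) hLm hL hvm
        (fun k z => (hinner k (v z)).trans (mul_le_mul_of_nonneg_left (hv z) hr)) hLv
      have h0 : ∀ z k, inner ℝ (t k) u +
          ∑ i, (L k ((Fin.cons z s : Fin (m + 1) → Z) i) - ∫ z, L k z ∂P) =
          inner ℝ (t k) u + ∑ i, (L k (s i) - ∫ z, L k z ∂P) + (L k z - ∫ z, L k z ∂P) :=
        fun z k => by
          rw [Fin.sum_univ_succ]
          simp only [Fin.cons_zero, Fin.cons_succ]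
          ring
      have hΦe : ∀ (e : ℝ) z, Φ (u + e • v z) s =
          ⨆ k, (inner ℝ (t k) u + ∑ i, (L k (s i) - ∫ z, L k z ∂P) + e * inner ℝ (t k) (v z)) :=
        fun e z => iSup_congr fun k => by rw [inner_add_right, inner_smul_right]; ring
      simp only [h0, hH, hΦe, neg_mul, ← sub_eq_add_neg]
      exact h
    rw [integral_pi_finCons P hmeas (fun w => abs_ciSup_le_of_abs_le fun k => hsum (m + 1) k w u)]
    calc _ ≤ ∫ s, ∫ z, H (s, z) ∂P ∂(Measure.pi fun _ : Fin m => P) := by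
          refine integral_mono (integrable_of_abs_le (C := r * ‖u‖ + (m + 1 : ℕ) * (2 * B))
            ?_ fun s => ?_) hHint.integral_prod_left hfst
          · exact (StronglyMeasurable.integral_prod_right (ν := P) (f := fun s z => ⨆ k,
              (inner ℝ (t k) u + ∑ i, (L k ((Fin.cons z s : Fin (m + 1) → Z) i) - ∫ z, L k z ∂P)))
              (hmeas.comp measurable_finCons).stronglyMeasurable).measurable
          · exact abs_integral_le_of_abs_le fun z =>
              abs_ciSup_le_of_abs_le fun k => hsum (m + 1) k _ u
      _ = ∫ z, ∫ s, H (s, z) ∂(Measure.pi fun _ : Fin m => P) ∂P :=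
          integral_integral_swap hHint
      _ ≤ ∫ _ : Z, r * √(‖u‖ ^ 2 + (m + 1 : ℕ) * (4 * κ ^ 2)) ∂P := by
          refine integral_mono hHint.integral_prod_right (integrable_const _) fun z => ?_
          have hsec : ∀ e : ℝ, Integrable (fun s => Φ (u + e • v z) s)
              (Measure.pi fun _ : Fin m => P) := fun e =>
            integrable_of_abs_le ((hΦm e).comp measurable_prodMk_right) fun s => hΦC s _
          simp only [hH]
          rw [integral_div, integral_add (hsec 2) (hsec (-2))]
          have hpar := sqrt_add_sqrt_div_two_le u ((2 : ℝ) • v z)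
            (show 0 ≤ m * (4 * κ ^ 2) by positivity)
          have hn : ‖(2 : ℝ) • v z‖ ^ 2 ≤ 4 * κ ^ 2 := by
            rw [norm_smul, mul_pow]
            norm_num
            exact pow_le_pow_left₀ (norm_nonneg _) (hv z) 2
          calc _ ≤ (r * √(‖u + (2 : ℝ) • v z‖ ^ 2 + m * (4 * κ ^ 2)) +
                r * √(‖u - (2 : ℝ) • v z‖ ^ 2 + m * (4 * κ ^ 2))) / 2 := by
                rw [sub_eq_add_neg, ← neg_smul]
                gcongr
                · exact ih _
                · exact ih _
            _ = r * ((√(‖u + (2 : ℝ) • v z‖ ^ 2 + m * (4 * κ ^ 2)) +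
                √(‖u - (2 : ℝ) • v z‖ ^ 2 + m * (4 * κ ^ 2))) / 2) := by ring
            _ ≤ r * √(‖u‖ ^ 2 + ‖(2 : ℝ) • v z‖ ^ 2 + m * (4 * κ ^ 2)) := by gcongr
            _ ≤ _ := by
                refine mul_le_mul_of_nonneg_left (Real.sqrt_le_sqrt ?_) hr
                push_cast
                linarith
      _ = _ := by simp

end Complexity

section ExponentialMoment

lemma sum_update_le {Z : Type*} {f : Z → ℝ} {B : ℝ} (h0 : ∀ z, 0 ≤ f z) (hB : ∀ z, f z ≤ B) (R : ℝ) {m : ℕ}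
    (w : Fin m → Z) (i : Fin m) (z : Z) :
    ∑ j, (f (Function.update w i z j) - R) ≤ ∑ j, (f (w j) - R) + B := by
  rw [← add_sum_erase _ _ (mem_univ i), ← add_sum_erase _ (fun j => f (w j) - R) (mem_univ i)]
  have : ∑ j ∈ univ.erase i, (f (Function.update w i z j) - R) =
      ∑ j ∈ univ.erase i, (f (w j) - R) :=
    sum_congr rfl fun j hj => by rw [Function.update_of_ne (ne_of_mem_erase hj)]
  rw [this, Function.update_self]
  linarith [h0 (w i), hB z]

variable {ι Z E : Type*} [MeasurableSpace Z] [NormedAddCommGroup E] [InnerProductSpace ℝ E]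

lemma measurable_ciSup_sum_sub [Countable ι] {L : ι → Z → ℝ} (hLm : ∀ k, Measurable (L k)) (R : ι → ℝ) (m : ℕ) :
    Measurable fun w : Fin m → Z => ⨆ k, ∑ i, (L k (w i) - R k) :=
  Measurable.iSup fun k => by
    have h : ∀ i, Measurable fun w : Fin m → Z => L k (w i) := fun i =>
      (hLm k).comp (measurable_pi_apply i)
    fun_prop

lemma abs_sum_sub_integral_le {P : Measure Z} [IsProbabilityMeasure P] {f : Z → ℝ} {B : ℝ}
    (h : ∀ z, |f z| ≤ B) {m : ℕ} (w : Fin m → Z) :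
    |∑ i, (f (w i) - ∫ z, f z ∂P)| ≤ m * (2 * B) :=
  (abs_sum_le_sum_abs _ _).trans ((sum_le_sum fun i _ => (abs_sub _ _).trans (by
    linarith [h (w i), abs_integral_le_of_abs_le (P := P) h] :
      |f (w i)| + |∫ z, f z ∂P| ≤ 2 * B)).trans_eq (by simp))

lemma integral_exp_ciSup_empirical_le [Countable ι] [Nonempty ι] (P : Measure Z) [IsProbabilityMeasure P] {t : ι → E}
    {L : ι → Z → ℝ} {v : Z → E} {B r κ l : ℝ} (hr : 0 ≤ r) (hκ : 0 ≤ κ) (hl : 0 ≤ l)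
    (ht : ∀ k, ‖t k‖ ≤ r) (hLm : ∀ k, Measurable (L k)) (hL0 : ∀ k z, 0 ≤ L k z)
    (hLB : ∀ k z, L k z ≤ B) (hvm : ∀ k, Measurable fun z => inner ℝ (t k) (v z))
    (hv : ∀ z, ‖v z‖ ≤ κ)
    (hLv : ∀ j k z, |L j z - L k z| ≤ |inner ℝ (t j) (v z) - inner ℝ (t k) (v z)|) (m : ℕ) :
    ∫ w : Fin m → Z, Real.exp (l * ⨆ k, ∑ i, (L k (w i) - ∫ z, L k z ∂P))
        ∂(Measure.pi fun _ => P) ≤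
      Real.exp (l * (2 * r * κ * √m) + m * (l ^ 2 * B ^ 2 / 8)) := by
  have hL : ∀ k z, |L k z| ≤ B := fun k z => by rw [abs_of_nonneg (hL0 k z)]; exact hLB k z
  have hmean := integral_ciSup_empirical_le P hr ht hLm hL hvm hv hLv m 0
  simp only [inner_zero_right, zero_add, norm_zero, ne_eq, OfNat.ofNat_ne_zero,
    not_false_eq_true, zero_pow] at hmean
  have hsqrt : √(m * (4 * κ ^ 2)) = 2 * κ * √m := by
    rw [show m * (4 * κ ^ 2) = (2 * κ) ^ 2 * m by ring, Real.sqrt_mul (by positivity),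
      Real.sqrt_sq (by positivity)]
  rw [hsqrt] at hmean
  have hC : ∀ w : Fin m → Z, ∀ k, |∑ i, (L k (w i) - ∫ z, L k z ∂P)| ≤ m * (2 * B) :=
    fun w k => abs_sum_sub_integral_le (hL k) w
  refine (integral_exp_le_of_bounded_differences P (measurable_ciSup_sum_sub hLm _ m)
    (fun w => abs_ciSup_le_of_abs_le (hC w)) (c := B) fun w i z => ?_).trans ?_
  · refine ciSup_le fun k => (sum_update_le (hL0 k) (hLB k) _ w i z).trans ?_
    gcongr
    exact le_ciSup (f := fun k => ∑ i, (L k (w i) - ∫ z, L k z ∂P))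
      (bddAbove_range_of_abs_le (hC w)) k
  · gcongr
    linarith

end ExponentialMoment

section Pairing

lemma sum_perm_apply_apply_eq {α : Type*} [Fintype α] [DecidableEq α] (G : α → α → ℝ)
    {a b a' b' : α} (h : a ≠ b) (h' : a' ≠ b') :
    ∑ π : Equiv.Perm α, G (π a) (π b) = ∑ π : Equiv.Perm α, G (π a') (π b') := by
  obtain ⟨ρ, rfl, rfl⟩ := MulAction.is_two_pretransitive_iff.1
    (Equiv.Perm.isMultiplyPretransitive α 2) h h'
  exact (Equiv.sum_comp (Equiv.mulRight ρ) fun π : Equiv.Perm α => G (π a) (π b)).symm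

lemma card_mul_sum_perm_eq {α : Type*} [Fintype α] [DecidableEq α] (G : α → α → ℝ)
    {a b : α} (h : a ≠ b) :
    (Fintype.card α * (Fintype.card α - 1) : ℝ) * ∑ π : Equiv.Perm α, G (π a) (π b) =
      (Fintype.card α).factorial * ∑ q ∈ (univ : Finset α).offDiag, G q.1 q.2 := by
  have hinv : ∀ π : Equiv.Perm α, ∑ q ∈ (univ : Finset α).offDiag, G (π q.1) (π q.2) =
      ∑ q ∈ (univ : Finset α).offDiag, G q.1 q.2 := fun π =>
    sum_equiv (π.prodCongr π) (by simp) (by simp)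
  have hcard : ((univ : Finset α).offDiag.card : ℝ) = Fintype.card α * (Fintype.card α - 1) := by
    rw [offDiag_card, Nat.cast_sub (Nat.le_mul_self _)]
    push_cast [card_univ]; ring
  calc _ = ∑ q ∈ (univ : Finset α).offDiag, ∑ π : Equiv.Perm α, G (π q.1) (π q.2) := by
        rw [sum_congr rfl fun q hq =>
          sum_perm_apply_apply_eq G (mem_offDiag.1 hq).2.2 h, sum_const, nsmul_eq_mul, hcard]
    _ = _ := by
        rw [sum_comm, sum_congr rfl fun π _ => hinv π, sum_const, nsmul_eq_mul, card_univ,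
          Fintype.card_perm]

lemma sum_offDiag_min_max {n : ℕ} (h : Fin n → Fin n → ℝ) :
    ∑ q ∈ (univ : Finset (Fin n)).offDiag, h (min q.1 q.2) (max q.1 q.2) =
      2 * ∑ i, ∑ j, if i < j then h i j else 0 := by
  have hpt : ∀ i j : Fin n, (if i ≠ j then h (min i j) (max i j) else 0) =
      (if i < j then h i j else 0) + if j < i then h j i else 0 := fun i j => by
    rcases lt_trichotomy i j with hij | rfl | hij
    · simp [hij.ne, hij, hij.le, hij.not_gt]
    · simp
    · simp [hij.ne', hij, hij.le, hij.not_gt]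
  have hoff : (univ : Finset (Fin n)).offDiag = univ.filter fun q : Fin n × Fin n => q.1 ≠ q.2 := by
    ext; simp
  rw [hoff, sum_filter, Fintype.sum_prod_type]
  simp only [hpt, sum_add_distrib]
  rw [sum_comm (f := fun i j : Fin n => if j < i then h j i else 0)]
  ring

/-- The sample pairs selected by the perfect matching `π (i) — π (m + i)`, oriented by index. -/
def matchedPairs {W : Type*} {m : ℕ} (π : Equiv.Perm (Fin (m + m))) (S : Fin (m + m) → W)
    (i : Fin m) : W × W :=
  (S (min (π (Fin.castAdd m i)) (π (Fin.natAdd m i))),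
    S (max (π (Fin.castAdd m i)) (π (Fin.natAdd m i))))

/-- A U-statistic of order two is an average of i.i.d. sums over perfect matchings. -/
lemma sum_perm_sum_matchedPairs {W : Type*} {m : ℕ} (f : W × W → ℝ) (S : Fin (m + m) → W) :
    ((m + m : ℕ) * ((m + m : ℕ) - 1) : ℝ) *
        ∑ π : Equiv.Perm (Fin (m + m)), ∑ i, f (matchedPairs π S i) =
      (m + m).factorial * (m * (2 * ∑ i, ∑ j, if i < j then f (S i, S j) else 0)) := by
  have h : ∀ i : Fin m, Fin.castAdd m i ≠ Fin.natAdd m i := fun i hi => by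
    have := congrArg Fin.val hi
    simp at this
    omega
  have hi : ∀ i : Fin m, ((m + m : ℕ) * ((m + m : ℕ) - 1) : ℝ) *
      ∑ π : Equiv.Perm (Fin (m + m)), f (matchedPairs π S i) =
        (m + m).factorial * (2 * ∑ i, ∑ j, if i < j then f (S i, S j) else 0) := fun i => by
    have := card_mul_sum_perm_eq (fun a b => f (S (min a b), S (max a b))) (h i)
    rwa [Fintype.card_fin, sum_offDiag_min_max fun a b => f (S a, S b)] at this
  rw [sum_comm, mul_sum, sum_congr rfl fun i _ => hi i, sum_const, nsmul_eq_mul, card_univ,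
    Fintype.card_fin]
  ring

lemma measurePreserving_pairs {W : Type*} [MeasurableSpace W] (D : Measure W)
    [IsProbabilityMeasure D] {m n : ℕ} (e : Fin m ⊕ Fin m ≃ Fin n) :
    MeasurePreserving (fun (S : Fin n → W) i => (S (e (.inl i)), S (e (.inr i))))
      (Measure.pi fun _ => D) (Measure.pi fun _ => D.prod D) :=
  ((measurePreserving_arrowProdEquivProdArrow W W (Fin m) (fun _ => D) (fun _ => D)).symm.comp
    (measurePreserving_sumPiEquivProdPi fun _ : Fin m ⊕ Fin m => D)).comp
      (measurePreserving_piCongrLeft (fun _ : Fin n => D) e).symm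

lemma measurePreserving_matchedPairs {W : Type*} [MeasurableSpace W] (D : Measure W)
    [IsProbabilityMeasure D] {m : ℕ} (π : Equiv.Perm (Fin (m + m))) :
    MeasurePreserving (matchedPairs (W := W) π) (Measure.pi fun _ => D)
      (Measure.pi fun _ => D.prod D) := by
  let x : Fin m → Fin (m + m) := fun i => π (Fin.castAdd m i)
  let y : Fin m → Fin (m + m) := fun i => π (Fin.natAdd m i)
  have hx : ∀ i j, x i = x j → i = j := fun i j h => Fin.castAdd_injective m m (π.injective h)
  have hy : ∀ i j, y i = y j → i = j := fun i j h => Fin.natAdd_injective m m (π.injective h)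
  have hxy : ∀ i j, x i ≠ y j := fun i j h => by
    have := congrArg Fin.val (π.injective h)
    simp at this
    omega
  let σ : Fin m ⊕ Fin m → Fin (m + m) :=
    Sum.elim (fun i => min (x i) (y i)) fun i => max (x i) (y i)
  have hσ : Function.Injective σ := by
    rintro (i | i) (j | j) h <;> simp only [σ, Sum.elim_inl, Sum.elim_inr] at h <;>
      grind
  have hbij : Function.Bijective σ :=
    (Fintype.bijective_iff_injective_and_card σ).2 ⟨hσ, by simp⟩
  exact measurePreserving_pairs D (Equiv.ofBijective σ hbij)

end Pairing

section UStatistic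

variable {ι W E : Type*} [MeasurableSpace W] [NormedAddCommGroup E] [InnerProductSpace ℝ E]
  [Countable ι] [Nonempty ι]

lemma measure_exists_lt_uStatistic_le (D : Measure W) [IsProbabilityMeasure D] {t : ι → E}
    {L : ι → W × W → ℝ} {v : W × W → E} {B r κ δ : ℝ} (hr : 0 ≤ r) (hκ : 0 ≤ κ) (hB : 0 < B)
    (ht : ∀ k, ‖t k‖ ≤ r) (hLm : ∀ k, Measurable (L k)) (hL0 : ∀ k z, 0 ≤ L k z)
    (hLB : ∀ k z, L k z ≤ B) (hvm : ∀ k, Measurable fun z => inner ℝ (t k) (v z))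
    (hv : ∀ z, ‖v z‖ ≤ κ)
    (hLv : ∀ j k z, |L j z - L k z| ≤ |inner ℝ (t j) (v z) - inner ℝ (t k) (v z)|)
    (hδ0 : 0 < δ) (hδ1 : δ < 1) {m : ℕ} (hm : 0 < m) :
    (Measure.pi fun _ : Fin (m + m) => D) {S | ∃ k,
      ∫ z, L k z ∂(D.prod D) + 2 * r * κ * √(2 / (m + m : ℕ)) +
        B * √(2 * Real.log (1 / δ) / (m + m : ℕ)) <
      2 / ((m + m : ℕ) * ((m + m : ℕ) - 1) : ℝ) *
        ∑ i, ∑ j, if i < j then L k (S i, S j) else 0} ≤ ENNReal.ofReal δ := by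
  have hm' : (0 : ℝ) < m := Nat.cast_pos.2 hm
  set R : ι → ℝ := fun k => ∫ z, L k z ∂(D.prod D) with hR
  set τ := √(Real.log (1 / δ) / m) with hτ
  have hlog : 0 < Real.log (1 / δ) := Real.log_pos (by rw [lt_div_iff₀ hδ0]; linarith)
  have hτ2 : m * τ ^ 2 = Real.log (1 / δ) := by
    rw [hτ, Real.sq_sqrt (by positivity)]; field_simp
  have e1 : √(2 / (m + m : ℕ)) = √m / m := by
    rw [Real.sqrt_div_self', Real.sqrt_eq_iff_mul_self_eq (by positivity) (by positivity)]
    push_cast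
    rw [div_mul_div_comm, Real.mul_self_sqrt hm'.le]
    field_simp
    ring
  have e2 : √(2 * Real.log (1 / δ) / (m + m : ℕ)) = τ := by
    rw [hτ]; congr 1; push_cast; field_simp; ring
  rw [e1, e2]
  set l := 4 * τ / B with hl
  have hl0 : 0 ≤ l := by positivity
  set Φ : (Fin m → W × W) → ℝ := fun w => ⨆ k, ∑ i, (L k (w i) - R k) with hΦ
  have hΦm : Measurable Φ := measurable_ciSup_sum_sub hLm R m
  have hLabs : ∀ k z, |L k z| ≤ B := fun k z => by rw [abs_of_nonneg (hL0 k z)]; exact hLB k z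
  have hterm : ∀ w : Fin m → W × W, ∀ k, |∑ i, (L k (w i) - R k)| ≤ m * (2 * B) :=
    fun w k => abs_sum_sub_integral_le (hLabs k) w
  have hΦC : ∀ w, |Φ w| ≤ m * (2 * B) := fun w => abs_ciSup_le_of_abs_le (hterm w)
  have hexpm : Measurable fun w => Real.exp (l * Φ w) := by fun_prop
  have hexpint : Integrable (fun w => Real.exp (l * Φ w)) (Measure.pi fun _ => D.prod D) :=
    integrable_of_abs_le (C := Real.exp (l * (m * (2 * B)))) hexpm fun w => by
      rw [Real.abs_exp, Real.exp_le_exp]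
      gcongr
      exact (le_abs_self _).trans (hΦC w)
  set N : ℝ := ((m + m).factorial : ℝ) with hN
  have hN0 : 0 < N := by positivity
  set H : (Fin (m + m) → W) → ℝ := fun S =>
    ∑ π : Equiv.Perm (Fin (m + m)), N⁻¹ * Real.exp (l * Φ (matchedPairs π S)) with hH
  have hmp := fun π : Equiv.Perm (Fin (m + m)) => measurePreserving_matchedPairs D π
  have hint : ∀ π : Equiv.Perm (Fin (m + m)),
      Integrable (fun S => N⁻¹ * Real.exp (l * Φ (matchedPairs π S)))
        (Measure.pi fun _ => D) := fun π =>
    ((hmp π).integrable_comp_of_integrable hexpint).const_mul _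
  have hcard : ∑ _π : Equiv.Perm (Fin (m + m)), N⁻¹ = 1 := by
    rw [sum_const, card_univ, Fintype.card_perm, Fintype.card_fin, nsmul_eq_mul]
    exact mul_inv_cancel₀ hN0.ne'
  have hHint : ∫ S, H S ∂(Measure.pi fun _ => D) ≤
      Real.exp (l * (2 * r * κ * √m) + m * (l ^ 2 * B ^ 2 / 8)) := by
    simp only [hH]
    rw [integral_finsetSum _ fun π _ => hint π]
    have hπ : ∀ π : Equiv.Perm (Fin (m + m)),
        ∫ S, N⁻¹ * Real.exp (l * Φ (matchedPairs π S)) ∂(Measure.pi fun _ => D) =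
          N⁻¹ * ∫ w, Real.exp (l * Φ w) ∂(Measure.pi fun _ => D.prod D) := fun π => by
      rw [integral_const_mul, ← (hmp π).map_eq, integral_map (hmp π).measurable.aemeasurable
        hexpm.aestronglyMeasurable]
    rw [sum_congr rfl fun π _ => hπ π, ← sum_mul, hcard, one_mul]
    exact integral_exp_ciSup_empirical_le (D.prod D) hr hκ hl0 ht hLm hL0 hLB hvm hv hLv m
  set θ := Real.exp (l * (m * (2 * r * κ * (√m / m) + B * τ))) with hθ
  have hsub : {S | ∃ k, R k + 2 * r * κ * (√m / m) + B * τ <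
      2 / ((m + m : ℕ) * ((m + m : ℕ) - 1) : ℝ) *
        ∑ i, ∑ j, if i < j then L k (S i, S j) else 0} ⊆ {S | θ ≤ H S} := by
    rintro S ⟨k, hk⟩
    have havg : m * (2 / ((m + m : ℕ) * ((m + m : ℕ) - 1) : ℝ) *
        (∑ i, ∑ j, if i < j then L k (S i, S j) else 0) - R k) =
          ∑ π : Equiv.Perm (Fin (m + m)), N⁻¹ * ∑ i, (L k (matchedPairs π S i) - R k) := by
      have h := sum_perm_sum_matchedPairs (L k) S
      have hpos : (0 : ℝ) < (m + m : ℕ) * ((m + m : ℕ) - 1) := by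
        have : (1 : ℝ) ≤ m := by exact_mod_cast hm
        push_cast
        exact mul_pos (by linarith) (by linarith)
      simp only [sum_sub_distrib, mul_sub, sum_const, card_univ, Fintype.card_fin, nsmul_eq_mul]
      rw [← mul_sum, Fintype.card_perm, Fintype.card_fin, mul_inv_cancel_left₀ hN0.ne']
      rw [eq_div_of_mul_eq hpos.ne' ((mul_comm _ _).trans h), ← hN]
      field_simp
    calc θ ≤ Real.exp (∑ π : Equiv.Perm (Fin (m + m)),
            N⁻¹ * (l * Φ (matchedPairs π S))) := by
          rw [hθ, Real.exp_le_exp]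
          calc _ ≤ l * (m * (2 / ((m + m : ℕ) * ((m + m : ℕ) - 1) : ℝ) *
                (∑ i, ∑ j, if i < j then L k (S i, S j) else 0) - R k)) := by
                gcongr
                linarith
            _ = ∑ π : Equiv.Perm (Fin (m + m)),
                N⁻¹ * (l * ∑ i, (L k (matchedPairs π S i) - R k)) := by
                rw [havg, mul_sum]
                exact sum_congr rfl fun π _ => by ring
            _ ≤ _ := by
                gcongr with π
                exact le_ciSup (f := fun k => ∑ i, (L k (matchedPairs π S i) - R k))
                  (bddAbove_range_of_abs_le (hterm _)) k
      _ ≤ H S := by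
          simpa only [smul_eq_mul] using convexOn_exp.map_sum_le
            (fun π _ => inv_nonneg.2 hN0.le) hcard
            fun (π : Equiv.Perm (Fin (m + m))) _ => Set.mem_univ (l * Φ (matchedPairs π S))
  have hmarkov := mul_meas_ge_le_integral_of_nonneg (μ := Measure.pi fun _ => D) (f := H)
    (Filter.Eventually.of_forall fun S => sum_nonneg fun π _ => by positivity)
    (integrable_finsetSum _ fun π _ => hint π) θ
  have hfin : Real.exp (l * (2 * r * κ * √m) + m * (l ^ 2 * B ^ 2 / 8)) ≤ θ * δ := by
    rw [hθ, ← Real.exp_log hδ0, ← Real.exp_add, Real.exp_le_exp]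
    have h1 : m * (l ^ 2 * B ^ 2 / 8) = 2 * (m * τ ^ 2) := by
      rw [hl]; field_simp; ring
    have h2 : l * (m * (2 * r * κ * (√m / m) + B * τ)) =
        l * (2 * r * κ * √m) + 4 * (m * τ ^ 2) := by
      rw [hl]; field_simp
    rw [h1, h2, hτ2]
    rw [one_div, Real.log_inv] at hlog ⊢
    linarith
  have hθ0 : 0 < θ := Real.exp_pos _
  refine (measure_mono hsub).trans ?_
  rw [← ENNReal.ofReal_toReal (measure_ne_top (Measure.pi fun _ => D) {S | θ ≤ H S})]
  exact ENNReal.ofReal_le_ofReal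
    (le_of_mul_le_mul_left ((hmarkov.trans hHint).trans hfin) hθ0)

end UStatistic

section PairwiseHinge

variable {X : Type*} {p : ℕ}

lemma l2norm_nonneg (μ : Fin p → ℝ) : 0 ≤ l2norm μ := Real.sqrt_nonneg _

lemma l2norm_eq_norm (μ : Fin p → ℝ) : l2norm μ = ‖WithLp.toLp 2 μ‖ := by
  simp [l2norm, EuclideanSpace.norm_eq]

lemma ip_eq_inner (μ v : Fin p → ℝ) :
    ip μ v = inner ℝ (WithLp.toLp 2 μ) (WithLp.toLp 2 v) := by
  simp [ip, PiLp.inner_apply, mul_comm]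

lemma abs_sgn (b : Bool) : |sgn b| = 1 := by cases b <;> simp [sgn]

/-- The label-signed feature vector of a pair of observations. -/
def signedFeature (K : Fin p → X → X → ℝ) (w : (X × Bool) × (X × Bool)) :
    EuclideanSpace ℝ (Fin p) :=
  WithLp.toLp 2 fun i => sgn w.1.2 * sgn w.2.2 * K i w.1.1 w.2.1

lemma hinge_eq (K : Fin p → X → X → ℝ) (μ : Fin p → ℝ) (w : (X × Bool) × (X × Bool)) :
    hinge K μ w.1 w.2 = max 0 (1 - inner ℝ (WithLp.toLp 2 μ) (signedFeature K w)) := by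
  rw [signedFeature, ← ip_eq_inner, hinge, ip, ip, mul_sum]
  congr 2
  exact sum_congr rfl fun i _ => by simp only [zmap]; ring

lemma norm_signedFeature_le {K : Fin p → X → X → ℝ} {κ : Fin p → ℝ}
    (hKb : ∀ i x x', |K i x x'| ≤ κ i ^ 2) (w : (X × Bool) × (X × Bool)) :
    ‖signedFeature K w‖ ≤ l2norm fun i => κ i ^ 2 := by
  rw [signedFeature, ← l2norm_eq_norm]
  refine Real.sqrt_le_sqrt (sum_le_sum fun i _ => sq_le_sq' ?_ ?_) <;>
  · have h : |sgn w.1.2 * sgn w.2.2 * K i w.1.1 w.2.1| ≤ κ i ^ 2 := by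
      rw [abs_mul, abs_mul, abs_sgn, abs_sgn]; simpa using hKb i _ _
    linarith [abs_le.1 h]

lemma hinge_nonneg (K : Fin p → X → X → ℝ) (μ : Fin p → ℝ) (w w' : X × Bool) :
    0 ≤ hinge K μ w w' := le_max_left _ _

lemma hinge_le {K : Fin p → X → X → ℝ} {κ : Fin p → ℝ}
    (hKb : ∀ i x x', |K i x x'| ≤ κ i ^ 2) {r : ℝ} (hr : 0 ≤ r) {μ : Fin p → ℝ}
    (hμ : l2norm μ ≤ r) (w w' : X × Bool) :
    hinge K μ w w' ≤ 1 + r * l2norm fun i => κ i ^ 2 := by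
  have h := abs_real_inner_le_norm (WithLp.toLp 2 μ) (signedFeature K (w, w'))
  have h' : ‖WithLp.toLp 2 μ‖ * ‖signedFeature K (w, w')‖ ≤ r * l2norm fun i => κ i ^ 2 :=
    mul_le_mul (by rwa [← l2norm_eq_norm]) (norm_signedFeature_le hKb _) (norm_nonneg _) hr
  have h0 := mul_nonneg hr (l2norm_nonneg fun i => κ i ^ 2)
  rw [hinge_eq K μ (w, w')]
  exact max_le (by linarith) (by linarith [(abs_le.1 (h.trans h')).1])

lemma abs_hinge_sub_le (K : Fin p → X → X → ℝ) (μ ν : Fin p → ℝ)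
    (w : (X × Bool) × (X × Bool)) :
    |hinge K μ w.1 w.2 - hinge K ν w.1 w.2| ≤
      |inner ℝ (WithLp.toLp 2 μ) (signedFeature K w) -
        inner ℝ (WithLp.toLp 2 ν) (signedFeature K w)| := by
  rw [hinge_eq, hinge_eq, max_comm 0, max_comm 0]
  refine (abs_max_sub_max_le_abs _ _ _).trans_eq ?_
  rw [sub_sub_sub_cancel_left, abs_sub_comm]

lemma measurable_inner_signedFeature [MeasurableSpace X] {K : Fin p → X → X → ℝ}
    (hKm : ∀ i, Measurable fun w : X × X => K i w.1 w.2) (μ : Fin p → ℝ) :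
    Measurable fun w => inner ℝ (WithLp.toLp 2 μ) (signedFeature K w) := by
  simp only [signedFeature, ← ip_eq_inner, ip]
  have hsgn : Measurable sgn := measurable_of_countable _
  have hK : ∀ i, Measurable fun w : (X × Bool) × (X × Bool) => K i w.1.1 w.2.1 := fun i =>
    (hKm i).comp (measurable_fst.fst.prodMk measurable_snd.fst)
  refine Finset.measurable_fun_sum _ fun i _ => Measurable.const_mul (Measurable.mul ?_ (hK i)) _
  exact (hsgn.comp measurable_fst.snd).mul (hsgn.comp measurable_snd.snd)

lemma measurable_hinge [MeasurableSpace X] {K : Fin p → X → X → ℝ}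
    (hKm : ∀ i, Measurable fun w : X × X => K i w.1 w.2) (μ : Fin p → ℝ) :
    Measurable fun w : (X × Bool) × (X × Bool) => hinge K μ w.1 w.2 := by
  simp only [hinge_eq]
  exact measurable_const.max (measurable_const.sub (measurable_inner_signedFeature hKm μ))

lemma continuous_hinge (K : Fin p → X → X → ℝ) (w w' : X × Bool) :
    Continuous fun μ => hinge K μ w w' := by
  unfold hinge ip
  fun_prop

lemma continuous_empRisk {n : ℕ} (K : Fin p → X → X → ℝ) (S : Fin n → X × Bool) :
    Continuous (empRisk K S) := by
  unfold empRisk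
  refine continuous_const.mul (continuous_finsetSum _ fun i _ => continuous_finsetSum _ fun j _ => ?_)
  split_ifs
  · exact continuous_hinge K _ _
  · exact continuous_const

lemma continuous_trueRisk_ball [MeasurableSpace X] {K : Fin p → X → X → ℝ}
    (hKm : ∀ i, Measurable fun w : X × X => K i w.1 w.2) {κ : Fin p → ℝ}
    (hKb : ∀ i x x', |K i x x'| ≤ κ i ^ 2) (D : Measure (X × Bool)) [IsProbabilityMeasure D]
    {r : ℝ} (hr : 0 ≤ r) :
    Continuous fun μ : {μ : Fin p → ℝ // l2norm μ ≤ r} => trueRisk K D μ :=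
  continuous_of_dominated (fun μ => (measurable_hinge hKm μ).aestronglyMeasurable)
    (fun μ => Filter.Eventually.of_forall fun w => by
      rw [Real.norm_of_nonneg (hinge_nonneg _ _ _ _)]; exact hinge_le hKb hr μ.2 _ _)
    (integrable_const _)
    (Filter.Eventually.of_forall fun w =>
      (continuous_hinge K w.1 w.2).comp continuous_subtype_val)

end PairwiseHinge

/-- uniform one-sided bound of empirical risk by true risk over a fixed
L2 ball, with high probability. -/
theorem stmt10 {X : Type*} [MeasurableSpace X] {p n : ℕ} (hn : 2 ≤ n) (hev : Even n)
    (K : Fin p → X → X → ℝ)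
    (hKm : ∀ i, Measurable (fun w : X × X => K i w.1 w.2))
    (κ : Fin p → ℝ) (hκ : ∀ i, 0 < κ i)
    (hKb : ∀ i x x', |K i x x'| ≤ κ i ^ 2)
    (D : Measure (X × Bool)) [IsProbabilityMeasure D]
    (r : ℝ) (hr : 0 < r) (δ : ℝ) (hδ0 : 0 < δ) (hδ1 : δ < 1) :
    ENNReal.ofReal (1 - δ) ≤
      (Measure.pi fun _ : Fin n => D) {S | ∀ μ : Fin p → ℝ, l2norm μ ≤ r →
        empRisk K S μ ≤ trueRisk K D μ +
          2 * r * l2norm (fun i => κ i ^ 2) * Real.sqrt (2 / (n : ℝ)) +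
          (1 + r * l2norm (fun i => κ i ^ 2)) * Real.sqrt (2 * Real.log (1 / δ) / n)} := by
  obtain ⟨m, rfl⟩ := hev
  set N := l2norm fun i => κ i ^ 2 with hN
  have hN0 : 0 ≤ N := l2norm_nonneg _
  have : Nonempty {μ : Fin p → ℝ // l2norm μ ≤ r} := ⟨0, by simpa [l2norm] using hr.le⟩
  let d : ℕ → {μ : Fin p → ℝ // l2norm μ ≤ r} := TopologicalSpace.denseSeq _
  have hd : DenseRange d := TopologicalSpace.denseRange_denseSeq _
  set c := 2 * r * N * √(2 / (m + m : ℕ)) +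
    (1 + r * N) * √(2 * Real.log (1 / δ) / (m + m : ℕ)) with hc
  have hbad := measure_exists_lt_uStatistic_le D (t := fun k => WithLp.toLp 2 (d k : Fin p → ℝ))
    (L := fun k w => hinge K (d k) w.1 w.2) (v := signedFeature K) (B := 1 + r * N) hr.le hN0
    (by positivity) (fun k => by rw [← l2norm_eq_norm]; exact (d k).2)
    (fun k => measurable_hinge hKm _) (fun k w => hinge_nonneg _ _ _ _)
    (fun k w => hinge_le hKb hr.le (d k).2 _ _) (fun k => measurable_inner_signedFeature hKm _)
    (norm_signedFeature_le hKb) (fun j k w => abs_hinge_sub_le K _ _ w) hδ0 hδ1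
    (show 0 < m by omega)
  set good : Set (Fin (m + m) → X × Bool) := {S | ∀ μ : Fin p → ℝ, l2norm μ ≤ r →
    empRisk K S μ ≤ trueRisk K D μ + 2 * r * N * √(2 / (m + m : ℕ)) +
      (1 + r * N) * √(2 * Real.log (1 / δ) / (m + m : ℕ))} with hgood
  have hcompl : (Measure.pi fun _ : Fin (m + m) => D) goodᶜ ≤ ENNReal.ofReal δ := by
    refine (measure_mono fun S hS => ?_).trans hbad
    by_contra hcon
    simp only [Set.mem_ofPred_eq, not_exists, not_lt] at hcon
    refine hS fun μ hμ => ?_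
    have hall := hd.induction_on
      (p := fun μ : {μ : Fin p → ℝ // l2norm μ ≤ r} => empRisk K S μ ≤ trueRisk K D μ + c)
      ⟨μ, hμ⟩ (isClosed_le ((continuous_empRisk K S).comp continuous_subtype_val)
        ((continuous_trueRisk_ball hKm hKb D hr.le).add continuous_const))
      fun k => (hcon k).trans_eq (add_assoc _ _ _)
    exact hall.trans_eq (add_assoc _ _ _).symm
  rw [ENNReal.ofReal_sub _ hδ0.le, ENNReal.ofReal_one, tsub_le_iff_right]
  calc 1 = (Measure.pi fun _ : Fin (m + m) => D) (good ∪ goodᶜ) := by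
        rw [Set.union_compl_self, measure_univ]
    _ ≤ _ := measure_union_le _ _
    _ ≤ _ := by gcongr
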